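/- There exists a finite constant c ≥ 1 such that, in every constrained composition setup, with δ = δ(w, z) and K_H = (1 + K_max · d_max)^H, the Kullback–Leibler divergence between the induced densities satisfies K(p_{C_w}, p_{C_z}) ≤ c · K_H² · δ² · (1 + K_H δ) · e^{K_H δ}. -/

import Mathlib

open Set MeasureTheory

/-- The cube `[-1,1]^n` in `ℝ^n`. -/
def cube (n : ℕ) : Set (Fin n → ℝ) := Set.univ.pi fun _ => Set.Icc (-1 : ℝ) 1

/-- Iterated composition of the layer maps: `iterComp d w k = w_k ∘ ⋯ ∘ w_1` in the paper's
1-indexed notation (0-indexed layers `h = 0, …, H-1` here). -/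
def iterComp (d : ℕ → ℕ) (w : ∀ h : ℕ, (Fin (d h) → ℝ) → (Fin (d (h + 1)) → ℝ)) :
    ∀ k : ℕ, (Fin (d 0) → ℝ) → (Fin (d k) → ℝ)
  | 0 => fun t => t
  | k + 1 => fun t => w k (iterComp d w k t)

/-- The density `p_F(t) = e^{F(t)} / ∫_{[-1,1]^n} e^{F(s)} ds` induced by `F` on `[-1,1]^n`. -/
noncomputable def pdens (n : ℕ) (F : (Fin n → ℝ) → ℝ) (t : Fin n → ℝ) : ℝ :=
  Real.exp (F t) / ∫ s in cube n, Real.exp (F s)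

/-- The Kullback–Leibler divergence `K(p,q) = ∫_{[-1,1]^n} log(p/q) p` between two densities. -/
noncomputable def klDiv (n : ℕ) (p q : (Fin n → ℝ) → ℝ) : ℝ :=
  ∫ t in cube n, Real.log (p t / q t) * p t

theorem cube_eq_Icc (n : ℕ) : cube n = Set.Icc (fun _ => (-1 : ℝ)) (fun _ => 1) :=
  Set.pi_univ_Icc _ _

theorem isCompact_cube (n : ℕ) : IsCompact (cube n) := by
  rw [cube_eq_Icc]
  exact isCompact_Icc

theorem convex_cube (n : ℕ) : Convex ℝ (cube n) := by
  rw [cube_eq_Icc]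
  exact convex_Icc _ _

theorem zero_mem_cube (n : ℕ) : (0 : Fin n → ℝ) ∈ cube n := fun _ _ => by simp

theorem mem_cube_of_abs_le {n : ℕ} {x : Fin n → ℝ} (hx : ∀ i, |x i| ≤ 1) : x ∈ cube n :=
  fun i _ => abs_le.1 (hx i)

theorem volume_cube_ne_zero (n : ℕ) : volume (cube n) ≠ 0 := by
  rw [cube_eq_Icc, Real.volume_Icc_pi, Finset.prod_ne_zero_iff]
  intro i _
  norm_num

theorem exp_sub_one_sub_id_le (x : ℝ) :
    Real.exp x - 1 - x ≤ |x| ^ 2 * Real.exp |x| := by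
  have h := Complex.norm_exp_sub_sum_le_norm_mul_exp (x : ℂ) 2
  have hsum : Complex.exp x - ∑ m ∈ Finset.range 2, (x : ℂ) ^ m / m.factorial
      = ((Real.exp x - 1 - x : ℝ) : ℂ) := by
    simp [Finset.sum_range_succ]
    ring
  rw [hsum, Complex.norm_real, Complex.norm_real, Real.norm_eq_abs, Real.norm_eq_abs] at h
  exact (le_abs_self _).trans h

theorem abs_image_sub_le_of_abs_partial_le {n : ℕ} {f : (Fin n → ℝ) → ℝ} {s : Set (Fin n → ℝ)}
    (hs : Convex ℝ s) (hf : DifferentiableOn ℝ f s) {K : ℝ} (hK : 0 ≤ K)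
    (hb : ∀ j, ∀ t ∈ s, |fderivWithin ℝ f s t (Pi.single j 1)| ≤ K)
    {x y : Fin n → ℝ} (hx : x ∈ s) (hy : y ∈ s) :
    |f x - f y| ≤ K * n * ‖x - y‖ := by
  have hop : ∀ t ∈ s, ‖fderivWithin ℝ f s t‖ ≤ K * n := by
    intro t ht
    refine ContinuousLinearMap.opNorm_le_bound _ (by positivity) fun v => ?_
    have hv : v = ∑ j, v j • (Pi.single j (1 : ℝ) : Fin n → ℝ) := by
      ext i
      simp [Finset.sum_apply, Pi.single_apply]
    calc ‖fderivWithin ℝ f s t v‖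
        = ‖∑ j, v j * fderivWithin ℝ f s t (Pi.single j 1)‖ := by
          conv_lhs => rw [hv]
          simp only [map_sum, map_smul, smul_eq_mul]
      _ ≤ ∑ j, ‖v j * fderivWithin ℝ f s t (Pi.single j 1)‖ := norm_sum_le _ _
      _ ≤ ∑ _j : Fin n, ‖v‖ * K := by
          refine Finset.sum_le_sum fun j _ => ?_
          rw [norm_mul]
          exact mul_le_mul (norm_le_pi_norm v j) (hb j t ht) (norm_nonneg _) (norm_nonneg _)
      _ = K * n * ‖v‖ := by
          simp
          ring
  exact hs.norm_image_sub_le_of_norm_fderivWithin_le hf hop hy hx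

theorem klDiv_pdens_le {n : ℕ} {F G : (Fin n → ℝ) → ℝ} (hF : ContinuousOn F (cube n))
    (hG : ContinuousOn G (cube n)) {ε : ℝ} (hε : ∀ t ∈ cube n, |F t - G t| ≤ ε) :
    klDiv n (pdens n F) (pdens n G) ≤ ε ^ 2 * Real.exp ε := by
  have hε0 : 0 ≤ ε := (abs_nonneg _).trans (hε 0 (zero_mem_cube n))
  have hc := isCompact_cube n
  have hm : MeasurableSet (cube n) := hc.measurableSet
  have hint : ∀ {f : (Fin n → ℝ) → ℝ}, ContinuousOn f (cube n) →
      Integrable f (volume.restrict (cube n)) := fun hf => hf.integrableOn_compact hc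
  have : NeZero (volume.restrict (cube n)) :=
    ⟨by simpa [Measure.restrict_eq_zero] using volume_cube_ne_zero n⟩
  have hZF : 0 < ∫ s in cube n, Real.exp (F s) := integral_exp_pos (hint hF.rexp)
  have hZG : 0 < ∫ s in cube n, Real.exp (G s) := integral_exp_pos (hint hG.rexp)
  set ZF := ∫ s in cube n, Real.exp (F s) with hZFdef
  set ZG := ∫ s in cube n, Real.exp (G s) with hZGdef
  have hlog : ∀ t, Real.log (pdens n F t / pdens n G t) = F t - G t + Real.log (ZG / ZF) := by
    intro t
    have : pdens n F t / pdens n G t = Real.exp (F t - G t) * (ZG / ZF) := by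
      simp only [pdens, ← hZFdef, ← hZGdef, Real.exp_sub]
      field_simp
    rw [this, Real.log_mul (Real.exp_ne_zero _) (by positivity), Real.log_exp]
  have hL : Real.log (ZG / ZF) ≤ ZG / ZF - 1 := Real.log_le_sub_one_of_pos (by positivity)
  have hpF : ContinuousOn (fun t => Real.exp (F t) / ZF) (cube n) := hF.rexp.div_const _
  have hpG : ContinuousOn (fun t => Real.exp (G t) / ZF) (cube n) := hG.rexp.div_const _
  have hDp : ContinuousOn (fun t => (F t - G t - 1) * (Real.exp (F t) / ZF)) (cube n) :=
    ((hF.sub hG).sub continuousOn_const).mul hpF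
  have hmass : ∫ t in cube n, Real.exp (F t) / ZF = 1 := by
    rw [integral_div, ← hZFdef, div_self hZF.ne']
  calc klDiv n (pdens n F) (pdens n G)
      = ∫ t in cube n, (F t - G t + Real.log (ZG / ZF)) * (Real.exp (F t) / ZF) := by
        simp only [klDiv, hlog]
        rfl
    _ ≤ ∫ t in cube n, ((F t - G t - 1) * (Real.exp (F t) / ZF)
          + ZG / ZF * (Real.exp (F t) / ZF)) := by
        refine setIntegral_mono_on
          (hint (((hF.sub hG).add continuousOn_const).mul hpF))
          (hint (hDp.add (continuousOn_const.mul hpF))) hm fun t _ => ?_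
        rw [← add_mul]
        refine mul_le_mul_of_nonneg_right ?_ (by positivity)
        linarith
    _ = ∫ t in cube n, ((F t - G t - 1) * (Real.exp (F t) / ZF) + Real.exp (G t) / ZF) := by
        rw [integral_add (hint hDp) ((hint hpF).const_mul _),
          integral_add (hint hDp) (hint hpG), integral_const_mul, hmass, integral_div,
          ← hZGdef, mul_one]
    _ ≤ ∫ t in cube n, ε ^ 2 * Real.exp ε * (Real.exp (F t) / ZF) := by
        refine setIntegral_mono_on (hint (hDp.add hpG))
          (hint (continuousOn_const.mul hpF)) hm fun t ht => ?_
        have hGF : Real.exp (G t) / ZF = Real.exp (G t - F t) * (Real.exp (F t) / ZF) := by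
          rw [Real.exp_sub]
          field_simp
        rw [hGF, ← add_mul]
        refine mul_le_mul_of_nonneg_right ?_ (by positivity)
        have h1 := exp_sub_one_sub_id_le (G t - F t)
        have h2 : |G t - F t| ≤ ε := by
          rw [abs_sub_comm]
          exact hε t ht
        have h3 : |G t - F t| ^ 2 * Real.exp |G t - F t| ≤ ε ^ 2 * Real.exp ε := by gcongr
        linarith
    _ = ε ^ 2 * Real.exp ε := by rw [integral_const_mul, hmass, mul_one]

section Composition

variable {d : ℕ → ℕ} {w z : ∀ h : ℕ, (Fin (d h) → ℝ) → (Fin (d (h + 1)) → ℝ)} {H : ℕ}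

theorem iterComp_mem_cube (hb : ∀ h, h + 1 < H → ∀ i, ∀ t ∈ cube (d h), |w h t i| ≤ 1)
    {t : Fin (d 0) → ℝ} (ht : t ∈ cube (d 0)) :
    ∀ {k : ℕ}, k < H → iterComp d w k t ∈ cube (d k)
  | 0, _ => ht
  | k + 1, hk => mem_cube_of_abs_le fun i =>
      hb k hk i _ (iterComp_mem_cube hb ht (Nat.lt_of_succ_lt hk))

theorem continuousOn_iterComp
    (hc : ∀ h, h < H → ∀ i, ContinuousOn (fun t => w h t i) (cube (d h)))
    (hb : ∀ h, h + 1 < H → ∀ i, ∀ t ∈ cube (d h), |w h t i| ≤ 1) :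
    ∀ {k : ℕ}, k ≤ H → ContinuousOn (iterComp d w k) (cube (d 0))
  | 0, _ => continuousOn_id
  | k + 1, hk => (continuousOn_pi.2 fun i => hc k hk i).comp
      (continuousOn_iterComp hc hb (Nat.le_of_succ_le hk))
      fun _ ht => iterComp_mem_cube hb ht hk

theorem abs_iterComp_sub_le {dmax : ℕ} (hd : ∀ h, h < H → d h ≤ dmax) {K : ℝ} (hK : 0 ≤ K)
    (hbw : ∀ h, h + 1 < H → ∀ i, ∀ t ∈ cube (d h), |w h t i| ≤ 1)
    (hbz : ∀ h, h + 1 < H → ∀ i, ∀ t ∈ cube (d h), |z h t i| ≤ 1)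
    (hw : ∀ h, 1 ≤ h → h < H → ∀ i, ContDiffOn ℝ 1 (fun t => w h t i) (cube (d h)))
    (hw' : ∀ h, 1 ≤ h → h < H → ∀ i j, ∀ t ∈ cube (d h),
      |fderivWithin ℝ (fun s => w h s i) (cube (d h)) t (Pi.single j 1)| ≤ K)
    {δ : ℝ} (hδ0 : 0 ≤ δ) (hδ : ∀ h, h < H → ∀ i, ∀ t ∈ cube (d h), |w h t i - z h t i| ≤ δ)
    {t : Fin (d 0) → ℝ} (ht : t ∈ cube (d 0)) :
    ∀ {k : ℕ}, k ≤ H → ∀ i,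
      |iterComp d w k t i - iterComp d z k t i| ≤ (1 + K * dmax) ^ k * δ := by
  intro k
  induction k with
  | zero => intro _ i; simpa [iterComp] using hδ0
  | succ k ih =>
    intro hk i
    have hA : 1 ≤ (1 + K * dmax) ^ k := one_le_pow₀ (by nlinarith [Nat.cast_nonneg (α := ℝ) dmax])
    have hz := hδ k hk i _ (iterComp_mem_cube hbz ht hk)
    have hlip : |w k (iterComp d w k t) i - w k (iterComp d z k t) i|
        ≤ K * dmax * ((1 + K * dmax) ^ k * δ) := by
      rcases Nat.eq_zero_or_pos k with rfl | hk0
      · simp only [iterComp, sub_self, abs_zero]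
        positivity
      · refine (abs_image_sub_le_of_abs_partial_le (convex_cube _)
          ((hw k hk0 hk i).differentiableOn one_ne_zero) hK (hw' k hk0 hk i)
          (iterComp_mem_cube hbw ht hk) (iterComp_mem_cube hbz ht hk)).trans ?_
        have hn : ‖iterComp d w k t - iterComp d z k t‖ ≤ (1 + K * dmax) ^ k * δ :=
          (pi_norm_le_iff_of_nonneg (by positivity)).2 fun j => ih (Nat.le_of_succ_le hk) j
        have hdk : (d k : ℝ) ≤ dmax := by exact_mod_cast hd k hk
        gcongr
    calc |iterComp d w (k + 1) t i - iterComp d z (k + 1) t i|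
        ≤ |w k (iterComp d w k t) i - w k (iterComp d z k t) i|
          + |w k (iterComp d z k t) i - z k (iterComp d z k t) i| := abs_sub_le _ _ _
      _ ≤ K * dmax * ((1 + K * dmax) ^ k * δ) + δ := add_le_add hlip hz
      _ ≤ K * dmax * ((1 + K * dmax) ^ k * δ) + (1 + K * dmax) ^ k * δ := by
          gcongr
          exact le_mul_of_one_le_left hδ0 hA
      _ = (1 + K * dmax) ^ (k + 1) * δ := by ring

end Composition

/-- there is a universal finite constant `c ≥ 1` such that in every constrained
composition setup, `K(p_{C_w}, p_{C_z}) ≤ c K_H² δ² (1 + K_H δ) e^{K_H δ}` with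
`K_H = (1 + K_max d_max)^H` and `δ = δ(w,z)`. -/
theorem stmt6 :
    ∃ c : ℝ, 1 ≤ c ∧
      ∀ (H : ℕ), 2 ≤ H →
      ∀ d : ℕ → ℕ, (∀ h, h ≤ H → 0 < d h) → d H = 1 →
      ∀ dmax : ℕ, (∀ h, h < H → d h ≤ dmax) →
      ∀ Kmax : ℝ, 0 < Kmax →
      ∀ w z : ∀ h : ℕ, (Fin (d h) → ℝ) → (Fin (d (h + 1)) → ℝ),
      (∀ h, h < H → ∀ i, ContinuousOn (fun t => w h t i) (cube (d h))) →
      (∀ h, h < H → ∀ i, ContinuousOn (fun t => z h t i) (cube (d h))) →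
      (∀ h, h + 1 < H → ∀ i, ∀ t ∈ cube (d h), |w h t i| ≤ 1) →
      (∀ h, h + 1 < H → ∀ i, ∀ t ∈ cube (d h), |z h t i| ≤ 1) →
      (∀ h, 1 ≤ h → h < H → ∀ i, ContDiffOn ℝ 1 (fun t => w h t i) (cube (d h))) →
      (∀ h, 1 ≤ h → h < H → ∀ i, ContDiffOn ℝ 1 (fun t => z h t i) (cube (d h))) →
      (∀ h, 1 ≤ h → h < H → ∀ i j, ∀ t ∈ cube (d h),
        |fderivWithin ℝ (fun s => w h s i) (cube (d h)) t (Pi.single j 1)| ≤ Kmax) →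
      (∀ h, 1 ≤ h → h < H → ∀ i j, ∀ t ∈ cube (d h),
        |fderivWithin ℝ (fun s => z h s i) (cube (d h)) t (Pi.single j 1)| ≤ Kmax) →
      ∀ δ : ℝ, (∀ h, h < H → ∀ i, ∀ t ∈ cube (d h), |w h t i - z h t i| ≤ δ) →
      ∀ i : Fin (d H),
        klDiv (d 0) (pdens (d 0) fun t => iterComp d w H t i)
            (pdens (d 0) fun t => iterComp d z H t i)
          ≤ c * ((1 + Kmax * dmax) ^ H) ^ 2 * δ ^ 2 * (1 + (1 + Kmax * dmax) ^ H * δ) *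
            Real.exp ((1 + Kmax * dmax) ^ H * δ) := by
  refine ⟨1, le_rfl, ?_⟩
  intro H hH d hd _ dmax hdmax K hK w z hcw hcz hbw hbz hw _ hw' _ δ hδ i
  have hδ0 : 0 ≤ δ :=
    (abs_nonneg _).trans (hδ 0 (by omega) ⟨0, hd 1 (by omega)⟩ 0 (zero_mem_cube _))
  have hkl := klDiv_pdens_le
    (continuousOn_pi.1 (continuousOn_iterComp hcw hbw le_rfl) i)
    (continuousOn_pi.1 (continuousOn_iterComp hcz hbz le_rfl) i)
    fun t ht => abs_iterComp_sub_le hdmax hK.le hbw hbz hw hw' hδ0 hδ ht le_rfl i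
  refine hkl.trans ?_
  rw [one_mul, mul_pow]
  refine mul_le_mul_of_nonneg_right (le_mul_of_one_le_right (by positivity) ?_) (by positivity)
  exact le_add_of_nonneg_right (by positivity)
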